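/- arXiv:1908.11110 — 2 statements merged into one kernel-verified Lean document; each statement's English description precedes it below -/
import Mathlib

section
/- Let V = V_n(q) with n ≥ 1 and q a power of a prime p, and let G be an affine permutation group of rank 3 on V with G_0 ≤ ΓL_n(q) and ⟨x⟩ \ {0} ⊆ x^{G_0} for some x ∈ V \ {0}. Let S = (V, 𝓛) be a G-affine proper partial linear space. If |L ∩ ⟨u⟩| ≥ 3 for some line L ∈ 𝓛 containing 0 and some u ∈ L \ {0}, then every line of S is an affine F_p-subspace of V. -/
open scoped Pointwise

/-- A partial linear space on the point set `P`: a set of lines (subsets of `P`) such that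
any two distinct points lie on at most one common line and every line has at least two
points. -/
structure PLS (P : Type*) where
  lines : Set (Set P)
  two_le_ncard : ∀ L ∈ lines, 2 ≤ L.ncard
  unique_of_pair : ∀ L₁ ∈ lines, ∀ L₂ ∈ lines, ∀ x y : P,
    x ≠ y → x ∈ L₁ → y ∈ L₁ → x ∈ L₂ → y ∈ L₂ → L₁ = L₂

namespace PLS

variable {P : Type*}

/-- Two points are collinear if they are distinct and lie on a common line. -/
def Collinear (S : PLS P) (x y : P) : Prop :=
  x ≠ y ∧ ∃ L ∈ S.lines, x ∈ L ∧ y ∈ L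

/-- The set of points collinear with `x`. -/
def nbrs (S : PLS P) (x : P) : Set P :=
  {y : P | S.Collinear x y}

/-- A linear space: any two distinct points lie on exactly one line. -/
def IsLinearSpace (S : PLS P) : Prop :=
  ∀ x y : P, x ≠ y → ∃! L, L ∈ S.lines ∧ x ∈ L ∧ y ∈ L

/-- A graph: every line has exactly two points. -/
def IsGraph (S : PLS P) : Prop :=
  ∀ L ∈ S.lines, L.ncard = 2

/-- Proper: neither a linear space nor a graph. -/
def IsProper (S : PLS P) : Prop :=
  ¬ S.IsLinearSpace ∧ ¬ S.IsGraph

/-- The automorphism group of `S`: all permutations of the point set mapping the line set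
onto itself. -/
def aut (S : PLS P) : Subgroup (Equiv.Perm P) :=
  MulAction.stabilizer (Equiv.Perm P) S.lines

end PLS

/-- The orbit of `x` under the stabiliser of `0` in `G`. -/
def zeroStabOrbit {V : Type*} [AddCommGroup V] (G : Subgroup (Equiv.Perm V)) (x : V) : Set V :=
  {y : V | ∃ g ∈ G, g 0 = 0 ∧ g x = y}

/-- `G` is an affine permutation group on `V`: it contains all translations, and every
element fixing `0` is additive. -/
def IsAffinePermGroup {V : Type*} [AddCommGroup V] (G : Subgroup (Equiv.Perm V)) : Prop :=
  (∀ v : V, Equiv.addRight v ∈ G) ∧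
    ∀ g ∈ G, g 0 = 0 → ∀ x y : V, g (x + y) = g x + g y

/-- The stabiliser of `0` in `G` has exactly two orbits on the set of nonzero vectors;
for an affine permutation group this says exactly that `G` has rank `3`. -/
def HasTwoZeroStabOrbits {V : Type*} [AddCommGroup V] (G : Subgroup (Equiv.Perm V)) : Prop :=
  ∃ x y : V, x ≠ 0 ∧ y ≠ 0 ∧ zeroStabOrbit G x ≠ zeroStabOrbit G y ∧
    ∀ z : V, z ≠ 0 → z ∈ zeroStabOrbit G x ∪ zeroStabOrbit G y

section FieldAction

variable {F : Type*} [Field F]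

/-- Every automorphism of a finite field acts on nonzero elements as a power map. -/
lemma exists_forall_ringEquiv_eq_pow [Finite F] (σ : F ≃+* F) :
    ∃ m : ℕ, ∀ x : F, x ≠ 0 → σ x = x ^ m := by
  obtain ⟨ζ, hζ⟩ := IsCyclic.exists_monoid_generator (α := Fˣ)
  obtain ⟨m, hm⟩ := hζ (Units.map (σ : F →* F) ζ)
  refine ⟨m, fun x hx => ?_⟩
  obtain ⟨k, hk⟩ := hζ (Units.mk0 x hx)
  have hk' : (ζ : F) ^ k = x := by
    simpa using congrArg (Units.val) hk
  have hm' : (ζ : F) ^ m = σ (ζ : F) := by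
    simpa using congrArg (Units.val) hm
  rw [← hk', map_pow, ← hm', ← pow_mul, ← pow_mul, mul_comm]

/-- Automorphisms of a finite field commute. -/
lemma ringEquiv_apply_comm [Finite F] (σ τ : F ≃+* F) (x : F) : σ (τ x) = τ (σ x) := by
  rcases eq_or_ne x 0 with rfl | hx
  · simp
  obtain ⟨m, hm⟩ := exists_forall_ringEquiv_eq_pow σ
  rw [hm x hx, hm (τ x) (by simpa using hx), map_pow]

/-- A permutation of a field of the form `s ↦ a * σ s + b`, `σ` a field automorphism. -/
def IsSemiaffine (g : Equiv.Perm F) : Prop :=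
  ∃ (a : F) (σ : F ≃+* F) (b : F), ∀ s, g s = a * σ s + b

/-- The commutator of two semiaffine permutations of a finite field is affine. -/
lemma IsSemiaffine.exists_affine_commutator [Finite F] {g h : Equiv.Perm F}
    (hg : IsSemiaffine g) (hh : IsSemiaffine h) :
    ∃ a b : F, ∀ s, (g * h * g⁻¹ * h⁻¹) s = a * s + b := by
  obtain ⟨a₁, σ, b₁, hg⟩ := hg
  obtain ⟨a₂, τ, b₂, hh⟩ := hh
  have ne_zero : ∀ (f : Equiv.Perm F) (a b : F) (ρ : F ≃+* F),
      (∀ s, f s = a * ρ s + b) → a ≠ 0 := by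
    rintro f a b ρ hf rfl
    exact zero_ne_one (f.injective (by simp [hf] : f 0 = f 1))
  have h₁ : σ a₂ ≠ 0 := by simpa using ne_zero h a₂ b₂ τ hh
  have h₂ : τ a₁ ≠ 0 := by simpa using ne_zero g a₁ b₁ σ hg
  have h₃ := ne_zero h a₂ b₂ τ hh
  refine ⟨a₁ * σ a₂ / (a₂ * τ a₁),
    a₁ * σ b₂ + b₁ - a₁ * σ a₂ / (a₂ * τ a₁) * (a₂ * τ b₁ + b₂), fun s => ?_⟩
  obtain ⟨r, rfl⟩ : ∃ r, s = h (g r) := ⟨g⁻¹ (h⁻¹ s), by simp⟩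
  have : (g * h * g⁻¹ * h⁻¹) (h (g r)) = g (h r) := by simp
  rw [this]
  simp only [hg, hh, map_add, map_mul, ringEquiv_apply_comm τ σ]
  field_simp
  ring

/-- Let `Γ` be a group of semiaffine permutations of a finite field which contains the
translations and whose stabiliser of `0` is transitive on nonzero elements.  A block `B` with
at least three points that is preserved by each element of `Γ` mapping two of its points into
`B` is invariant under a nontrivial translation. -/
lemma exists_translation_of_semiaffine_linearSpace [Finite F] (Γ : Subgroup (Equiv.Perm F))
    (hsemi : ∀ g ∈ Γ, IsSemiaffine g)
    (htrans : ∀ t : F, Equiv.addRight t ∈ Γ)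
    (horbit : ∀ a : F, a ≠ 0 → ∃ g ∈ Γ, g 0 = 0 ∧ g 1 = a)
    (B : Set F) (hcard : 2 < B.ncard)
    (hB : ∀ g ∈ Γ, ∀ x ∈ B, ∀ y ∈ B, x ≠ y → g x ∈ B → g y ∈ B → ∀ s, g s ∈ B ↔ s ∈ B) :
    ∃ t : F, t ≠ 0 ∧ ∀ s ∈ B, s + t ∈ B := by
  by_contra! hno
  have third : ∀ y z : F, ∃ x ∈ B, x ≠ y ∧ x ≠ z := by
    intro y z
    obtain ⟨a, b, c, ha, hb, hc, hab, hac, hbc⟩ := (Set.two_lt_ncard_iff).1 hcard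
    by_contra! H
    have key : ∀ x ∈ B, x = y ∨ x = z := fun x hx => or_iff_not_imp_left.2 (H x hx)
    rcases key a ha with rfl | rfl <;> rcases key b hb with rfl | rfl <;>
      rcases key c hc with rfl | rfl <;> simp_all
  have twoTrans : ∀ x y x' y' : F, x ≠ y → x' ≠ y' → ∃ g ∈ Γ, g x = x' ∧ g y = y' := by
    intro x y x' y' hxy hxy'
    obtain ⟨g₁, hg₁, h10, h11⟩ := horbit (y - x) (sub_ne_zero.2 hxy.symm)
    obtain ⟨g₂, hg₂, h20, h21⟩ := horbit (y' - x') (sub_ne_zero.2 hxy'.symm)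
    refine ⟨Equiv.addRight x' * g₂ * g₁⁻¹ * Equiv.addRight (-x),
      mul_mem (mul_mem (mul_mem (htrans _) hg₂) (inv_mem hg₁)) (htrans _), ?_, ?_⟩
    · have : g₁.symm 0 = 0 := by rw [Equiv.symm_apply_eq, h10]
      simp [this, h20]
    · have : g₁.symm (y - x) = 1 := by rw [Equiv.symm_apply_eq, h11]
      simp [← sub_eq_add_neg, this, h21]
  let Γ' : Subgroup (Equiv.Perm F) :=
    { carrier := {g | g ∈ Γ ∧ ∀ s, g s ∈ B ↔ s ∈ B}
      mul_mem' := fun {g h} hg hh => ⟨mul_mem hg.1 hh.1, fun s => by simp [hg.2, hh.2]⟩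
      one_mem' := ⟨one_mem _, fun s => by simp⟩
      inv_mem' := fun {g} hg => ⟨inv_mem hg.1, fun s => by simpa using (hg.2 (g⁻¹ s)).symm⟩ }
  have blockTrans : ∀ x ∈ B, ∀ y ∈ B, ∀ x' ∈ B, ∀ y' ∈ B, x ≠ y → x' ≠ y' →
      ∃ g ∈ Γ', g x = x' ∧ g y = y' := by
    intro x hx y hy x' hx' y' hy' hxy hxy'
    obtain ⟨g, hg, rfl, rfl⟩ := twoTrans x y x' y' hxy hxy'
    exact ⟨g, ⟨hg, hB g hg x hx y hy hxy hx' hy'⟩, rfl, rfl⟩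
  have transZero : ∀ t : F, (∀ s ∈ B, s + t ∈ B) → t = 0 := by
    intro t ht
    by_contra h0
    obtain ⟨s, hs, hst⟩ := hno t h0
    exact hst (ht s hs)
  -- Commutators give affine elements of the block stabiliser carrying `y` to `z`.
  have affineTrans : ∀ y ∈ B, ∀ z ∈ B, y ≠ z →
      ∃ n ∈ Γ', (∃ a b : F, ∀ s, n s = a * s + b) ∧ n y = z := by
    intro y hy z hz hyz
    obtain ⟨x, hx, hxy, hxz⟩ := third y z
    obtain ⟨g, hg, hgx, hgy⟩ := blockTrans x hx y hy x hx z hz hxy hxz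
    obtain ⟨h, hh, hhx, hhy⟩ := blockTrans x hx y hy y hy x hx hxy hxy.symm
    refine ⟨g * h * g⁻¹ * h⁻¹, mul_mem (mul_mem (mul_mem hg hh) (inv_mem hg)) (inv_mem hh),
      (hsemi g hg.1).exists_affine_commutator (hsemi h hh.1), ?_⟩
    have e₁ : h.symm y = x := by rw [Equiv.symm_apply_eq, hhx]
    have e₂ : g.symm x = x := by rw [Equiv.symm_apply_eq, hgx]
    simp [e₁, e₂, hhx, hgy]
  have affineComm : ∀ n₁ ∈ Γ', ∀ n₂ ∈ Γ', (∃ a b : F, ∀ s, n₁ s = a * s + b) →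
      (∃ a b : F, ∀ s, n₂ s = a * s + b) → ∀ s, n₁ (n₂ s) = n₂ (n₁ s) := by
    rintro n₁ h₁ n₂ h₂ ⟨a₁, b₁, e₁⟩ ⟨a₂, b₂, e₂⟩
    have key : (a₁ * b₂ + b₁) - (a₂ * b₁ + b₂) = 0 := by
      refine transZero _ fun s hs => ?_
      obtain ⟨r, rfl⟩ : ∃ r, s = n₂ (n₁ r) := ⟨n₁⁻¹ (n₂⁻¹ s), by simp⟩
      have : n₂ (n₁ r) + ((a₁ * b₂ + b₁) - (a₂ * b₁ + b₂)) = n₁ (n₂ r) := by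
        simp only [e₁, e₂]; ring
      rw [this, h₁.2, h₂.2]
      rwa [h₂.2, h₁.2] at hs
    intro s
    simp only [e₁, e₂]
    linear_combination key
  obtain ⟨y, hy, -, -⟩ := third 0 0
  obtain ⟨z, hz, hzy, -⟩ := third y y
  obtain ⟨n, hn, ⟨a, b, hab⟩, hnyz⟩ := affineTrans y hy z hz hzy.symm
  have ha : a ≠ 1 := by
    rintro rfl
    have hb : b = 0 := by
      refine transZero b fun s hs => ?_
      have := (hn.2 s).2 hs
      rwa [hab, one_mul] at this
    apply hzy
    rw [← hnyz, hab, hb]; ring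
  obtain ⟨c, hc⟩ : ∃ c, n c = c := by
    refine ⟨b / (1 - a), ?_⟩
    have : 1 - a ≠ 0 := sub_ne_zero.2 ha.symm
    rw [hab]; field_simp; ring
  have fixUnique : ∀ s, n s = s → s = c := by
    intro s hs
    rw [hab] at hs hc
    have : (a - 1) * (s - c) = 0 := by linear_combination hs - hc
    rcases mul_eq_zero.1 this with h | h
    · exact absurd (sub_eq_zero.1 h) ha
    · exact sub_eq_zero.1 h
  have affineFix : ∀ m ∈ Γ', (∃ a b : F, ∀ s, m s = a * s + b) → m c = c := by
    intro m hm hm'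
    apply fixUnique
    rw [affineComm n hn m hm ⟨a, b, hab⟩ hm', hc]
  have hcB : c ∉ B := by
    intro hcB
    obtain ⟨x, hx, hxc, -⟩ := third c c
    obtain ⟨m, hm, hm', hmc⟩ := affineTrans c hcB x hx hxc.symm
    exact hxc (by rw [← hmc, affineFix m hm hm'])
  have hyc : y - c ≠ 0 := sub_ne_zero.2 fun h => hcB (h ▸ hy)
  have hyc' : -(y - c) ≠ 0 := neg_ne_zero.2 hyc
  obtain ⟨h, hh, hh0, hhy⟩ := twoTrans 0 (y - c) 0 (-(y - c)) hyc.symm hyc'.symm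
  obtain ⟨α, τ, β, hτ⟩ := hsemi h hh
  have hβ : β = 0 := by simpa [hτ] using hh0
  subst hβ
  obtain ⟨m, hm⟩ := exists_forall_ringEquiv_eq_pow τ
  have negMem : ∀ s ∈ B, c - h (s - c) ∈ B := by
    intro s hs
    obtain ⟨k, hk, ⟨a', b', hk'⟩, hks⟩ : ∃ k ∈ Γ', (∃ a b : F, ∀ s, k s = a * s + b) ∧ k y = s := by
      rcases eq_or_ne y s with rfl | hne
      · exact ⟨1, one_mem _, ⟨1, 0, by simp⟩, by simp⟩
      · exact affineTrans y hy s hs hne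
    have hkc : a' * c + b' = c := by rw [← hk', affineFix k hk ⟨a', b', hk'⟩]
    have ha' : a' ≠ 0 := by
      rintro rfl
      exact zero_ne_one (k.injective (by simp [hk'] : k 0 = k 1))
    have hpow : ∀ j : ℕ, (k ^ j) y = a' ^ j * (y - c) + c := by
      intro j
      induction j with
      | zero => simp
      | succ j ih =>
        rw [pow_succ', Equiv.Perm.mul_apply, ih, hk']
        linear_combination hkc
    have hsc : s - c = a' * (y - c) := by
      rw [← hks, hk']; linear_combination hkc
    have : c - h (s - c) = (k ^ m) y := by
      rw [hpow, hsc, hτ, map_mul, hm a' ha']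
      rw [hτ] at hhy
      linear_combination -(a' ^ m) * hhy
    rw [this]
    exact ((pow_mem hk m : k ^ m ∈ Γ').2 y).2 hy
  have negSurj : ∀ s ∈ B, ∃ r ∈ B, h (r - c) = c - s := by
    have inj : Function.Injective fun s => c - h (s - c) := fun s r hsr => by simpa using hsr
    have heq : (fun s => c - h (s - c)) '' B = B :=
      Set.eq_of_subset_of_ncard_le (Set.image_subset_iff.2 negMem)
        (Set.ncard_image_of_injective B inj).ge
    intro s hs
    rw [← heq] at hs
    obtain ⟨r, hr, hrs⟩ := hs
    exact ⟨r, hr, by simp [← hrs]⟩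
  have reflect : ∀ b₁ ∈ B, ∀ b₂ ∈ B, b₁ ≠ b₂ → ∀ s ∈ B, b₁ + b₂ - s ∈ B := by
    intro b₁ h₁ b₂ h₂ h12 s hs
    obtain ⟨r₁, hr₁, e₁⟩ := negSurj b₁ h₁
    obtain ⟨r₂, hr₂, e₂⟩ := negSurj b₂ h₂
    obtain ⟨r, hr, e⟩ := negSurj s hs
    have hne : r₁ ≠ r₂ := by
      rintro rfl
      exact h12 (by linear_combination e₁ - e₂)
    have hg : ∀ v, (Equiv.addRight (b₁ + b₂ - c) * h * Equiv.addRight (-c)) v =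
        h (v - c) + (b₁ + b₂ - c) := fun v => by simp [sub_eq_add_neg]
    have key := hB (Equiv.addRight (b₁ + b₂ - c) * h * Equiv.addRight (-c))
      (mul_mem (mul_mem (htrans _) hh) (htrans _)) r₁ hr₁ r₂ hr₂ hne
      (by rw [hg, e₁]; convert h₂ using 1; ring) (by rw [hg, e₂]; convert h₁ using 1; ring) r
    rw [hg, e] at key
    convert key.2 hr using 1
    ring
  obtain ⟨x, hx, hxy, hxz⟩ := third y z
  apply hzy
  have : z - y = 0 := by
    refine transZero _ fun s hs => ?_
    convert reflect x hx z hz hxz _ (reflect x hx y hy hxy s hs) using 1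
    ring
  exact sub_eq_zero.1 this

end FieldAction

section TwoOrbits

variable {V : Type*} [AddCommGroup V] {G : Subgroup (Equiv.Perm V)}

lemma mem_zeroStabOrbit_symm {v w : V} (h : w ∈ zeroStabOrbit G v) : v ∈ zeroStabOrbit G w := by
  obtain ⟨g, hg, h0, rfl⟩ := h
  exact ⟨g⁻¹, inv_mem hg, by rw [Equiv.Perm.inv_eq_iff_eq, h0], by simp⟩

lemma mem_zeroStabOrbit_trans {v w z : V} (h : w ∈ zeroStabOrbit G v)
    (h' : z ∈ zeroStabOrbit G w) : z ∈ zeroStabOrbit G v := by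
  obtain ⟨g, hg, h0, rfl⟩ := h
  obtain ⟨k, hk, k0, rfl⟩ := h'
  exact ⟨k * g, mul_mem hk hg, by simp [h0, k0], by simp⟩

/-- With two orbits on nonzero vectors, two inequivalent vectors represent all orbits. -/
lemma HasTwoZeroStabOrbits.mem_or_mem (hrank : HasTwoZeroStabOrbits G) {v w z : V}
    (hv : v ≠ 0) (hw : w ≠ 0) (hz : z ≠ 0) (hvw : w ∉ zeroStabOrbit G v) :
    z ∈ zeroStabOrbit G v ∨ z ∈ zeroStabOrbit G w := by
  obtain ⟨x, y, -, -, -, hxy⟩ := hrank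
  rcases hxy v hv with h₁ | h₁ <;> rcases hxy w hw with h₂ | h₂ <;> rcases hxy z hz with h₃ | h₃
  all_goals first
    | exact absurd (mem_zeroStabOrbit_trans (mem_zeroStabOrbit_symm h₁) h₂) hvw
    | exact Or.inl (mem_zeroStabOrbit_trans (mem_zeroStabOrbit_symm h₁) h₃)
    | exact Or.inr (mem_zeroStabOrbit_trans (mem_zeroStabOrbit_symm h₂) h₃)

/-- If one orbit contains a punctured one-dimensional space, then every orbit on nonzero
vectors is closed under nonzero scalars. -/
lemma smul_mem_zeroStabOrbit {F : Type*} [Field F] [Module F V]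
    (hrank : HasTwoZeroStabOrbits G)
    (hsemi : ∀ g ∈ G, g 0 = 0 → ∃ σ : F ≃+* F, ∀ (c : F) (v : V), g (c • v) = σ c • g v)
    {x : V} (hx0 : x ≠ 0)
    (hx : (Submodule.span F ({x} : Set V) : Set V) \ {0} ⊆ zeroStabOrbit G x)
    {v : V} (hv : v ≠ 0) {a : F} (ha : a ≠ 0) : a • v ∈ zeroStabOrbit G v := by
  have closed : ∀ (b : F) (z : V), b ≠ 0 → z ∈ zeroStabOrbit G x → b • z ∈ zeroStabOrbit G x := by
    rintro b z hb ⟨g, hg, h0, rfl⟩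
    obtain ⟨σ, hσ⟩ := hsemi g hg h0
    have hmem : σ.symm b • x ∈ zeroStabOrbit G x :=
      hx ⟨Submodule.smul_mem _ _ (Submodule.mem_span_singleton_self x), by simp [hb, hx0]⟩
    exact mem_zeroStabOrbit_trans hmem ⟨g, hg, h0, by simp [hσ]⟩
  by_cases hvx : v ∈ zeroStabOrbit G x
  · exact mem_zeroStabOrbit_trans (mem_zeroStabOrbit_symm hvx) (closed a v ha hvx)
  · rcases hrank.mem_or_mem hx0 hv (smul_ne_zero ha hv) hvx with h | h
    · refine absurd ?_ hvx
      simpa [smul_smul, ha] using closed a⁻¹ _ (inv_ne_zero ha) h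
    · exact h

lemma PLS.image_mem_lines {P : Type*} {S : PLS P} {g : Equiv.Perm P} (hg : g ∈ S.aut)
    {L : Set P} (hL : L ∈ S.lines) : g '' L ∈ S.lines := by
  have h : g • S.lines = S.lines := hg
  rw [← h]
  exact Set.smul_mem_smul_set (a := g) hL

/-- In a non-linear space, all points collinear with `0` lie in one orbit. -/
lemma mem_zeroStabOrbit_of_collinear_zero
    (haff : IsAffinePermGroup G) (hrank : HasTwoZeroStabOrbits G) {S : PLS V} (hGS : G ≤ S.aut)
    (hS : ¬ S.IsLinearSpace) {v w : V} (hv : S.Collinear 0 v) (hw : S.Collinear 0 w) :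
    w ∈ zeroStabOrbit G v := by
  by_contra hvw
  have orbitCollinear : ∀ v z : V, S.Collinear 0 v → z ∈ zeroStabOrbit G v →
      ∃ L ∈ S.lines, (0 : V) ∈ L ∧ z ∈ L := by
    rintro v z ⟨-, L, hL, h0, hvL⟩ ⟨g, hg, hg0, rfl⟩
    exact ⟨g '' L, PLS.image_mem_lines (hGS hg) hL, ⟨0, h0, hg0⟩, ⟨v, hvL, rfl⟩⟩
  apply hS
  intro x y hxy
  have hyx : y - x ≠ 0 := sub_ne_zero.2 hxy.symm
  obtain ⟨L, hL, h0, hz⟩ : ∃ L ∈ S.lines, (0 : V) ∈ L ∧ y - x ∈ L := by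
    rcases hrank.mem_or_mem hv.1.symm hw.1.symm hyx hvw with h | h
    · exact orbitCollinear v _ hv h
    · exact orbitCollinear w _ hw h
  have hL' : (Equiv.addRight x) '' L ∈ S.lines := PLS.image_mem_lines (hGS (haff.1 x)) hL
  have hxL : x ∈ (Equiv.addRight x) '' L := ⟨0, h0, by simp⟩
  have hyL : y ∈ (Equiv.addRight x) '' L := ⟨y - x, hz, by simp⟩
  exact ⟨_, ⟨hL', hxL, hyL⟩, fun M hM =>
    S.unique_of_pair _ hM.1 _ hL' x y hxy hM.2.1 hM.2.2 hxL hyL⟩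

/-- A line with three points in a one-dimensional space `⟨u⟩` is invariant under translation
by a nonzero multiple of `u`. -/
lemma exists_translation_of_three_on_span {F : Type*} [Field F] [Finite F] [Module F V]
    (haff : IsAffinePermGroup G)
    (hsemi : ∀ g ∈ G, g 0 = 0 → ∃ σ : F ≃+* F, ∀ (c : F) (v : V), g (c • v) = σ c • g v)
    {S : PLS V} (hGS : G ≤ S.aut) {L : Set V} (hL : L ∈ S.lines) {u : V} (hu : u ≠ 0)
    (horbit : ∀ a : F, a ≠ 0 → a • u ∈ zeroStabOrbit G u)
    (hcard : 3 ≤ (L ∩ (Submodule.span F ({u} : Set V) : Set V)).ncard) :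
    ∃ t : V, t ≠ 0 ∧ ∀ v ∈ L, v + t ∈ L := by
  have hinj : Function.Injective fun s : F => s • u := smul_left_injective F hu
  let Γ : Subgroup (Equiv.Perm F) :=
    { carrier := {g | ∃ h ∈ G, ∀ s, h (s • u) = g s • u}
      mul_mem' := by
        rintro g₁ g₂ ⟨h₁, hh₁, e₁⟩ ⟨h₂, hh₂, e₂⟩
        exact ⟨h₁ * h₂, mul_mem hh₁ hh₂, fun s => by simp [e₁, e₂]⟩
      one_mem' := ⟨1, one_mem _, fun s => rfl⟩
      inv_mem' := by
        rintro g ⟨h, hh, e⟩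
        exact ⟨h⁻¹, inv_mem hh, fun s => by rw [Equiv.Perm.inv_eq_iff_eq, e]; simp⟩ }
  have htrans : ∀ t : F, Equiv.addRight t ∈ Γ := fun t =>
    ⟨Equiv.addRight (t • u), haff.1 _, fun s => by simp [add_smul]⟩
  have hΓsemi : ∀ g ∈ Γ, IsSemiaffine g := by
    rintro g ⟨h, hh, e⟩
    obtain ⟨σ, hσ⟩ := hsemi (Equiv.addRight (-(h 0)) * h) (mul_mem (haff.1 _) hh) (by simp)
    refine ⟨g 1 - g 0, σ, g 0, fun s => hinj ?_⟩
    have h0 : h 0 = g 0 • u := by simpa using e 0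
    have h1 : h u = g 1 • u := by simpa using e 1
    have hs := hσ s u
    simp only [Equiv.Perm.mul_apply, Equiv.coe_addRight, e, h0, h1] at hs
    simp only [add_smul, sub_smul, mul_comm _ (σ s), mul_smul]
    rw [← sub_eq_iff_eq_add, sub_eq_add_neg, hs, sub_eq_add_neg]
  have hΓorbit : ∀ a : F, a ≠ 0 → ∃ g ∈ Γ, g 0 = 0 ∧ g 1 = a := by
    intro a ha
    obtain ⟨h, hh, h0, hu'⟩ := horbit a ha
    obtain ⟨σ, hσ⟩ := hsemi h hh h0
    exact ⟨σ.toEquiv.trans (Equiv.mulRight₀ a ha),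
      ⟨h, hh, fun s => by simp [hσ, hu', mul_smul]⟩, by simp, by simp⟩
  let B : Set F := {s | s • u ∈ L}
  have himage : (fun s : F => s • u) '' B = L ∩ (Submodule.span F ({u} : Set V) : Set V) := by
    ext v
    simp only [B, Set.mem_image, Set.mem_ofPred_eq, Set.mem_inter_iff, SetLike.mem_coe,
      Submodule.mem_span_singleton]
    constructor
    · rintro ⟨s, hs, rfl⟩
      exact ⟨hs, s, rfl⟩
    · rintro ⟨hv, s, rfl⟩
      exact ⟨s, hv, rfl⟩
  have hBcard : 2 < B.ncard := by
    rw [← himage, Set.ncard_image_of_injective B hinj] at hcard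
    omega
  obtain ⟨t, ht, hBt⟩ := exists_translation_of_semiaffine_linearSpace Γ hΓsemi htrans hΓorbit B
    hBcard (by
      rintro g ⟨h, hh, e⟩ x hx y hy hxy hgx hgy s
      have hhL : h '' L = L := S.unique_of_pair _ (PLS.image_mem_lines (hGS hh) hL) _ hL
        (h (x • u)) (h (y • u)) (fun H => hxy (hinj (h.injective H))) ⟨_, hx, rfl⟩ ⟨_, hy, rfl⟩
        (by rw [e]; exact hgx) (by rw [e]; exact hgy)
      change g s • u ∈ L ↔ s • u ∈ L
      rw [← e]
      conv_lhs => rw [← hhL]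
      exact h.injective.mem_set_image)
  obtain ⟨a, b, -, ha, hb, -, hab, -, -⟩ := (Set.two_lt_ncard_iff).1 hBcard
  have hLt : (Equiv.addRight (t • u)) '' L = L :=
    S.unique_of_pair _ (PLS.image_mem_lines (hGS (haff.1 _)) hL) _ hL
      ((a + t) • u) ((b + t) • u) (fun H => hab (add_right_cancel (hinj H)))
      ⟨a • u, ha, by simp [add_smul]⟩ ⟨b • u, hb, by simp [add_smul]⟩ (hBt a ha) (hBt b hb)
  refine ⟨t • u, smul_ne_zero ht hu, fun v hv => ?_⟩
  rw [← hLt]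
  exact ⟨v, hv, rfl⟩

end TwoOrbits

/-- **Lemma 4.4.** Let `G` be an affine rank 3 permutation group on `V = V_n(q)`,
`q = p^e`, with `G₀ ≤ ΓL_n(q)` and the punctured span condition, and let `S` be a
`G`-affine proper partial linear space.  If `|L ∩ ⟨u⟩| ≥ 3` for some line `L` through `0`
and some `u ∈ L \ {0}`, then every line of `S` is an affine `F_p`-subspace of `V`. -/
theorem lines_affine_of_three_on_span
    {n p e : ℕ} (hn : 1 ≤ n) (hp : p.Prime)
    (F : Type*) [Field F] [Fintype F] (hcard : Fintype.card F = p ^ e)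
    (V : Type*) [AddCommGroup V] [Module F V] [Finite V]
    (hdim : Module.finrank F V = n)
    (G : Subgroup (Equiv.Perm V))
    (haff : IsAffinePermGroup G) (hrank : HasTwoZeroStabOrbits G)
    (hsemi : ∀ g ∈ G, g 0 = 0 →
      ∃ σ : F ≃+* F, ∀ (c : F) (v : V), g (c • v) = σ c • g v)
    (hx : ∃ x : V, x ≠ 0 ∧
      (Submodule.span F ({x} : Set V) : Set V) \ {0} ⊆ zeroStabOrbit G x)
    (S : PLS V) (hproper : S.IsProper) (hGS : G ≤ S.aut)
    (hbig : ∃ L ∈ S.lines, (0 : V) ∈ L ∧ ∃ u ∈ L, u ≠ 0 ∧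
      3 ≤ (L ∩ (Submodule.span F ({u} : Set V) : Set V)).ncard) :
    ∀ M ∈ S.lines, ∃ (W : AddSubgroup V) (v : V),
      M = (fun w : V => w + v) '' (W : Set V) := by
  obtain ⟨x, hx0, hx⟩ := hx
  obtain ⟨L, hL, h0L, u, huL, hu, hcardL⟩ := hbig
  obtain ⟨t, ht, hLt⟩ := exists_translation_of_three_on_span haff hsemi hGS hL hu
    (fun a ha => smul_mem_zeroStabOrbit hrank hsemi hx0 hx hu ha) hcardL
  have htL : t ∈ L := by simpa using hLt 0 h0L
  have addMem : ∀ M ∈ S.lines, (0 : V) ∈ M → ∀ v ∈ M, ∀ w ∈ M, v + w ∈ M := by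
    intro M hM h0M v hv w hw
    rcases eq_or_ne w 0 with rfl | hw0
    · simpa using hv
    obtain ⟨g, hg, hg0, hgt⟩ := mem_zeroStabOrbit_of_collinear_zero haff hrank hGS hproper.1
      ⟨ht.symm, L, hL, h0L, htL⟩ ⟨hw0.symm, M, hM, h0M, hw⟩
    have hgL : g '' L = M := S.unique_of_pair _ (PLS.image_mem_lines (hGS hg) hL) _ hM 0 w
      hw0.symm ⟨0, h0L, hg0⟩ ⟨t, htL, hgt⟩ h0M hw
    rw [← hgL] at hv
    obtain ⟨l, hl, rfl⟩ := hv
    rw [← hgL]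
    exact ⟨l + t, hLt l hl, by rw [haff.2 g hg hg0, hgt]⟩
  intro M hM
  obtain ⟨v, hv⟩ : M.Nonempty := Set.nonempty_of_ncard_ne_zero (by
    have := S.two_le_ncard M hM
    omega)
  have hM' : (Equiv.addRight (-v)) '' M ∈ S.lines := PLS.image_mem_lines (hGS (haff.1 _)) hM
  have h0M' : (0 : V) ∈ (Equiv.addRight (-v)) '' M := ⟨v, hv, by simp⟩
  let W₀ : AddSubmonoid V :=
    { carrier := (Equiv.addRight (-v)) '' M
      zero_mem' := h0M'
      add_mem' := fun {a b} ha hb => addMem _ hM' h0M' a ha b hb }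
  let W : AddSubgroup V :=
    { W₀ with
      neg_mem' := fun {w} hw => by
        have hneg : -w ∈ AddSubmonoid.multiples w :=
          mem_multiples_iff_mem_zmultiples.2 (neg_mem (AddSubgroup.mem_zmultiples w))
        exact (AddSubmonoid.multiples_le.2 (show w ∈ W₀ from hw)) hneg }
  refine ⟨W, v, ?_⟩
  change M = (fun w : V => w + v) '' ((Equiv.addRight (-v)) '' M)
  rw [Set.image_image]
  simp
end

section
/- Let q be a power of a prime p, let W = V_5(q), and let V = Λ²(W) be the exterior square of W, regarded as a vector space over F_p. Let G be an affine permutation group of rank 3 on V such that the image of SL_5(q) = SL(W) in GL(V) under the exterior-square representation (where g ∈ SL(W) acts by u ∧ v ↦ u^g ∧ v^g) is a normal subgroup of the zero-stabilizer G_0. Then there is no F_q-independent G-affine proper partial linear space; that is, for every G-affine proper partial linear space (V, 𝓛), every line L containing 0 satisfies L ⊆ ⟨x⟩ (the F_q-span of x) for every x ∈ L \ {0}. -/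
open scoped Pointwise

/-- The image of `SL(W)` inside the permutations of the exterior square `⋀[F]^2 W`:
the permutations induced by determinant-one linear automorphisms of `W` via
`u ∧ v ↦ u^g ∧ v^g`. -/
def slExteriorSquare (F W : Type*) [Field F] [AddCommGroup W] [Module F W] :
    Set (Equiv.Perm ↥(⋀[F]^2 W)) :=
  {π : Equiv.Perm ↥(⋀[F]^2 W) |
    ∃ g : W ≃ₗ[F] W, LinearMap.det g.toLinearMap = 1 ∧
      ∀ x : ↥(⋀[F]^2 W),
        ((π x : ↥(⋀[F]^2 W)) : ExteriorAlgebra F W) =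
          ExteriorAlgebra.map g.toLinearMap ((x : ↥(⋀[F]^2 W)) : ExteriorAlgebra F W)}

namespace exteriorPower

variable {F W : Type*} [Field F] [AddCommGroup W] [Module F W]

/-- The exterior product of two vectors, as a bilinear map into the exterior square. -/
noncomputable def wedge : W →ₗ[F] W →ₗ[F] ↥(⋀[F]^2 W) :=
  LinearMap.mk₂ F (fun a b => ιMulti F 2 ![a, b])
    (fun a a' b => Subtype.ext <| by
      simp [ExteriorAlgebra.ιMulti_apply, add_mul])
    (fun c a b => Subtype.ext <| by simp [ExteriorAlgebra.ιMulti_apply])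
    (fun a b b' => Subtype.ext <| by simp [ExteriorAlgebra.ιMulti_apply, mul_add])
    (fun c a b => Subtype.ext <| by simp [ExteriorAlgebra.ιMulti_apply])

lemma coe_wedge (a b : W) :
    (wedge (F := F) a b : ExteriorAlgebra F W) = ExteriorAlgebra.ι F a * ExteriorAlgebra.ι F b := by
  simp [wedge, ExteriorAlgebra.ιMulti_apply]

@[simp]
lemma wedge_self (a : W) : wedge (F := F) a a = 0 :=
  Subtype.ext <| by simp [coe_wedge]

lemma wedge_swap (a b : W) : wedge (F := F) b a = -wedge (F := F) a b := by
  have h := wedge_self (F := F) (a + b)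
  simp only [map_add, LinearMap.add_apply, wedge_self, zero_add, add_zero] at h
  exact eq_neg_of_add_eq_zero_left h

@[simp]
lemma map_wedge (g : W →ₗ[F] W) (a b : W) :
    map 2 g (wedge (F := F) a b) = wedge (F := F) (g a) (g b) := by
  change map 2 g (ιMulti F 2 ![a, b]) = ιMulti F 2 ![g a, g b]
  rw [map_apply_ιMulti]
  congr 1
  ext i
  fin_cases i <;> rfl

@[elab_as_elim]
lemma wedge_induction {motive : ↥(⋀[F]^2 W) → Prop} (wedge : ∀ a b, motive (wedge (F := F) a b))
    (zero : motive 0) (add : ∀ x y, motive x → motive y → motive (x + y))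
    (smul : ∀ (c : F) x, motive x → motive (c • x)) (x : ↥(⋀[F]^2 W)) : motive x := by
  have hx : x ∈ Submodule.span F (Set.range (ιMulti F 2 (M := W))) := by
    rw [ιMulti_span]
    trivial
  induction hx using Submodule.span_induction with
  | mem x h =>
    obtain ⟨u, rfl⟩ := h
    have hu : u = ![u 0, u 1] := by
      ext i
      fin_cases i <;> rfl
    rw [hu]
    exact wedge _ _
  | zero => exact zero
  | add x y _ _ hx hy => exact add x y hx hy
  | smul c x _ hx => exact smul c x hx

/-- Contraction of a bivector with a linear form. -/
noncomputable def contract : Module.Dual F W →ₗ[F] ↥(⋀[F]^2 W) →ₗ[F] W :=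
  LinearMap.mk₂ F
    (fun f x => ExteriorAlgebra.ιInv
      (CliffordAlgebra.contractLeft (Q := (0 : QuadraticForm F W)) f x.1))
    (fun f g x => by simp)
    (fun c f x => by simp)
    (fun f x y => by simp)
    (fun c f x => by simp)

lemma contract_wedge (f : Module.Dual F W) (a b : W) :
    contract f (wedge a b) = f a • b - f b • a := by
  change ExteriorAlgebra.ιInv (CliffordAlgebra.contractLeft (Q := (0 : QuadraticForm F W)) f
    (wedge (F := F) a b).1) = _
  rw [coe_wedge]
  have h : CliffordAlgebra.contractLeft (Q := (0 : QuadraticForm F W)) f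
      (ExteriorAlgebra.ι F a * ExteriorAlgebra.ι F b) =
      ExteriorAlgebra.ι F (f a • b - f b • a) := by
    refine (CliffordAlgebra.contractLeft_ι_mul (Q := (0 : QuadraticForm F W)) (d := f) a _).trans ?_
    have h2 := CliffordAlgebra.contractLeft_ι (Q := (0 : QuadraticForm F W)) (d := f) b
    change CliffordAlgebra.contractLeft (Q := (0 : QuadraticForm F W)) f (ExteriorAlgebra.ι F b)
      = _ at h2
    rw [h2, map_sub, map_smul, map_smul, ← Algebra.commutes, ← Algebra.smul_def]
  rw [h, ExteriorAlgebra.ι_leftInverse]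

lemma apply_contract_swap (f g : Module.Dual F W) (x : ↥(⋀[F]^2 W)) :
    f (contract g x) = -g (contract f x) := by
  induction x using wedge_induction with
  | wedge a b => simp [contract_wedge]; ring
  | zero => simp
  | add x y hx hy => simp [hx, hy]; ring
  | smul c x hx => simp [hx]

@[simp]
lemma apply_contract_self (f : Module.Dual F W) (x : ↥(⋀[F]^2 W)) : f (contract f x) = 0 := by
  induction x using wedge_induction with
  | wedge a b => simp [contract_wedge]; ring
  | zero => simp
  | add x y hx hy => simp [hx, hy]
  | smul c x hx => simp [hx]

lemma map_transvection (f : Module.Dual F W) (a : W) (x : ↥(⋀[F]^2 W)) :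
    map 2 (LinearMap.transvection f a) x = x + wedge a (contract f x) := by
  induction x using wedge_induction with
  | wedge u v =>
    simp only [map_wedge, LinearMap.transvection.apply, contract_wedge, map_add, map_sub, map_smul,
      LinearMap.add_apply, LinearMap.smul_apply, wedge_self, wedge_swap a u]
    module
  | zero => simp
  | add x y hx hy => simp only [map_add, hx, hy]; abel
  | smul c x hx => simp only [map_smul, hx, smul_add]

lemma eq_zero_of_contract_eq_zero [Module.Finite F W] {x : ↥(⋀[F]^2 W)}
    (hx : ∀ f, contract f x = 0) : x = 0 := by
  classical
  let b := Module.finBasis F W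
  suffices h : ∀ s : Finset (Fin (Module.finrank F W)), ∃ P : W →ₗ[F] W,
      (∀ i, P (b i) = if i ∈ s then 0 else b i) ∧ map 2 P x = x by
    obtain ⟨P, hP, hPx⟩ := h Finset.univ
    have hP0 : P = 0 := b.ext fun i => by simp [hP]
    have h0 : ∀ y : ↥(⋀[F]^2 W), map 2 (0 : W →ₗ[F] W) y = 0 := fun y => by
      induction y using wedge_induction with
      | wedge u v => simp
      | zero => simp
      | add x y hx hy => simp [hx, hy]
      | smul c x hx => simp [hx]
    rw [← hPx, hP0, h0]
  intro s
  induction s using Finset.induction_on with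
  | empty => exact ⟨LinearMap.id, by simp, by simp⟩
  | insert j s hj ih =>
    obtain ⟨P, hP, hPx⟩ := ih
    refine ⟨LinearMap.transvection (b.coord j) (-b j) ∘ₗ P, fun i => ?_, ?_⟩
    · by_cases hi : i ∈ s
      · simp [hP, hi]
      · by_cases hij : i = j
        · subst hij
          simp [hP, hi, LinearMap.transvection.apply]
        · simp [hP, hi, hij, LinearMap.transvection.apply]
    · have := congrArg (· x) (map_comp (n := 2) P (LinearMap.transvection (b.coord j) (-b j)))
      simp only [LinearMap.comp_apply] at this
      rw [this, hPx, map_transvection, hx, map_zero, add_zero]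

/-- If the contractions of `y` are all proportional to those of `x ≠ 0`, then `y` is proportional
to `x`. -/
lemma mem_span_of_contract_mem_span [Module.Finite F W] {x y : ↥(⋀[F]^2 W)} (hx : x ≠ 0)
    (h : ∀ f, contract f y ∈ Submodule.span F {contract f x}) :
    y ∈ Submodule.span F {x} := by
  obtain ⟨f, hf⟩ : ∃ f, contract f x ≠ 0 := by
    by_contra! h0
    exact hx (eq_zero_of_contract_eq_zero h0)
  obtain ⟨c, hc⟩ := Submodule.mem_span_singleton.1 (h f)
  have indep : ∀ g, f (contract g x) ≠ 0 → contract g y = c • contract g x := by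
    intro g hg
    obtain ⟨c₁, h₁⟩ := Submodule.mem_span_singleton.1 (h g)
    obtain ⟨c₂, h₂⟩ := Submodule.mem_span_singleton.1 (h (f + g))
    have key : (c₂ - c) • contract f x + (c₂ - c₁) • contract g x = 0 := by
      simp only [map_add, LinearMap.add_apply, ← hc, ← h₁] at h₂
      rw [← sub_eq_zero.2 h₂]
      module
    have h₂₁ : c₂ - c₁ = 0 := by
      have := congrArg f key
      simpa [hg] using this
    have h₂c : c₂ - c = 0 := by simpa [h₂₁, hf] using key
    rw [← h₁]
    congr 1
    linear_combination h₂c - h₂₁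
  obtain ⟨k, hk⟩ : ∃ k : Module.Dual F W, k (contract f x) ≠ 0 := by
    by_contra! h0
    exact hf ((Module.forall_dual_apply_eq_zero_iff F _).1 h0)
  have hfk : f (contract k x) ≠ 0 := by
    rw [apply_contract_swap]
    exact neg_ne_zero.2 hk
  have all : ∀ g, contract g y = c • contract g x := by
    intro g
    by_cases hg : f (contract g x) = 0
    · have h1 := indep (g + k) (by simpa [hg] using hfk)
      have h2 := indep k hfk
      simp only [map_add, LinearMap.add_apply, smul_add, h2] at h1
      exact add_right_cancel h1
    · exact indep g hg
  refine Submodule.mem_span_singleton.2 ⟨c, ?_⟩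
  rw [← sub_eq_zero]
  refine eq_zero_of_contract_eq_zero fun g => ?_
  rw [map_sub, map_smul, all, sub_self]

lemma linearIndependent_cons_cons {n : ℕ} {u : Fin n → W} (hu : LinearIndependent F u)
    {f g : Module.Dual F W} {a b : W} (hfu : ∀ i, f (u i) = 0) (hgu : ∀ i, g (u i) = 0)
    (hfb : f b ≠ 0) (hga : g a ≠ 0) (hgb : g b = 0) :
    LinearIndependent F (Fin.cons a (Fin.cons b u : Fin (n + 1) → W) : Fin (n + 2) → W) := by
  have key : ∀ {m : ℕ} {w : Fin m → W} {k : Module.Dual F W} {z : W}, (∀ i, k (w i) = 0) →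
      k z ≠ 0 → z ∉ Submodule.span F (Set.range w) := by
    intro m w k z hw hz hmem
    have : Submodule.span F (Set.range w) ≤ LinearMap.ker k := by
      rw [Submodule.span_le]
      rintro _ ⟨i, rfl⟩
      exact hw i
    exact hz (this hmem)
  refine linearIndependent_finCons.2 ⟨linearIndependent_finCons.2 ⟨hu, key hfu hfb⟩, key ?_ hga⟩
  intro i
  refine Fin.cases ?_ (fun j => ?_) i
  · simpa using hgb
  · simpa using hgu j

/-- A nonzero bivector is reduced by splitting off a hyperbolic plane. -/
lemma exists_contract_sub_wedge [Module.Finite F W] {x : ↥(⋀[F]^2 W)} (hx : x ≠ 0) :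
    ∃ (f g : Module.Dual F W) (a b : W), f a = 0 ∧ f b ≠ 0 ∧ g a ≠ 0 ∧ g b = 0 ∧
      contract f (x - wedge a b) = 0 ∧ contract g (x - wedge a b) = 0 ∧
      ∀ h, contract h x = 0 → h a = 0 ∧ h b = 0 ∧ contract h (x - wedge a b) = 0 := by
  obtain ⟨f, hf⟩ : ∃ f, contract f x ≠ 0 := by
    by_contra! h0
    exact hx (eq_zero_of_contract_eq_zero h0)
  obtain ⟨g, hg⟩ := Module.Projective.exists_dual_ne_zero F hf
  obtain ⟨k, hk⟩ : ∃ k : Module.Dual F W, k (contract f x) = 1 :=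
    ⟨(g (contract f x))⁻¹ • g, by simp [hg]⟩
  have hfk : f (contract k x) = -1 := by rw [apply_contract_swap, hk]
  refine ⟨f, k, contract f x, contract k x, by simp, by simp [hfk], by simp [hk], by simp, ?_, ?_,
    fun h hh => ?_⟩
  · simp [contract_wedge, hfk]
  · simp [contract_wedge, hk]
  · have h1 : h (contract f x) = 0 := by rw [apply_contract_swap, hh, map_zero, neg_zero]
    have h2 : h (contract k x) = 0 := by rw [apply_contract_swap, hh, map_zero, neg_zero]
    exact ⟨h1, h2, by simp [contract_wedge, hh, h1, h2]⟩

/-- In dimension at most five, every nonzero bivector has rank two or four. -/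
lemma eq_wedge_or_eq_wedge_add_wedge [Module.Finite F W] (hW : Module.finrank F W ≤ 5)
    {x : ↥(⋀[F]^2 W)} (hx : x ≠ 0) :
    (∃ a b : W, LinearIndependent F ![a, b] ∧ x = wedge a b) ∨
      ∃ a b c d : W, LinearIndependent F ![a, b, c, d] ∧ x = wedge a b + wedge c d := by
  obtain ⟨f, g, a, b, hfa, hfb, hga, hgb, hf, hg, -⟩ := exists_contract_sub_wedge hx
  by_cases hx₁ : x - wedge a b = 0
  · exact .inl ⟨a, b, linearIndependent_cons_cons (u := ![]) (linearIndependent_empty_type)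
      (by simp) (by simp) hfb hga hgb, sub_eq_zero.1 hx₁⟩
  obtain ⟨f', g', c, d, hfc', hfd', hgc', hgd', hf', hg', h'⟩ := exists_contract_sub_wedge hx₁
  obtain ⟨hfc, hfd, hf₂⟩ := h' f hf
  obtain ⟨hgc, hgd, hg₂⟩ := h' g hg
  by_cases hx₂ : x - wedge a b - wedge c d = 0
  · refine .inr ⟨a, b, c, d, ?_, ?_⟩
    · refine linearIndependent_cons_cons (u := ![c, d]) ?_ ?_ ?_ hfb hga hgb
      · exact linearIndependent_cons_cons (u := ![]) (linearIndependent_empty_type)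
          (by simp) (by simp) hfd' hgc' hgd'
      · simp [Fin.forall_fin_two, hfc, hfd]
      · simp [Fin.forall_fin_two, hgc, hgd]
    · rw [← sub_eq_zero, ← hx₂]
      abel
  exfalso
  obtain ⟨f'', g'', u, v, -, hfv'', hgu'', hgv'', -, -, h''⟩ := exists_contract_sub_wedge hx₂
  obtain ⟨hfu, hfv, -⟩ := h'' f hf₂
  obtain ⟨hgu, hgv, -⟩ := h'' g hg₂
  obtain ⟨hfu', hfv', -⟩ := h'' f' hf'
  obtain ⟨hgu', hgv', -⟩ := h'' g' hg'
  have h6 : LinearIndependent F ![a, b, c, d, u, v] := by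
    refine linearIndependent_cons_cons (u := ![c, d, u, v]) ?_ ?_ ?_ hfb hga hgb
    · refine linearIndependent_cons_cons (u := ![u, v]) ?_ ?_ ?_ hfd' hgc' hgd'
      · exact linearIndependent_cons_cons (u := ![]) (linearIndependent_empty_type)
          (by simp) (by simp) hfv'' hgu'' hgv''
      · simp [Fin.forall_fin_two, hfu', hfv']
      · simp [Fin.forall_fin_two, hgu', hgv']
    · simp [Fin.forall_fin_succ, hfc, hfd, hfu, hfv]
    · simp [Fin.forall_fin_succ, hgc, hgd, hgu, hgv]
  have := h6.fintype_card_le_finrank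
  simp at this
  omega

/-- The special linear group is transitive on linearly independent families that are not bases. -/
lemma exists_det_eq_one_of_linearIndependent [Module.Finite F W] {n : ℕ}
    (hn : n < Module.finrank F W) {u v : Fin n → W} (hu : LinearIndependent F u)
    (hv : LinearIndependent F v) :
    ∃ g : W ≃ₗ[F] W, LinearMap.det g.toLinearMap = 1 ∧ ∀ i, g (u i) = v i := by
  obtain ⟨k, hk⟩ := Nat.exists_eq_add_of_lt hn
  induction k generalizing n with
  | succ k ih =>
    obtain ⟨s, hs⟩ := exists_linearIndependent_snoc_of_lt_finrank hu hn
    obtain ⟨t, ht⟩ := exists_linearIndependent_snoc_of_lt_finrank hv hn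
    obtain ⟨g, hg, hguv⟩ := ih (by omega) hs ht (by omega)
    exact ⟨g, hg, fun i => by simpa using hguv i.castSucc⟩
  | zero =>
    obtain ⟨s, hs⟩ := exists_linearIndependent_snoc_of_lt_finrank hu hn
    obtain ⟨t, ht⟩ := exists_linearIndependent_snoc_of_lt_finrank hv hn
    let bu := basisOfLinearIndependentOfCardEqFinrank hs (by simp [hk])
    let bv := basisOfLinearIndependentOfCardEqFinrank ht (by simp [hk])
    let e := bu.equiv bv (Equiv.refl _)
    have hδ : LinearMap.det e.toLinearMap ≠ 0 := e.isUnit_det'.ne_zero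
    set δ := LinearMap.det e.toLinearMap with hδ_def
    let T := LinearMap.transvection (bv.coord (Fin.last n)) ((δ⁻¹ - 1) • bv (Fin.last n))
    have hT : LinearMap.det T = δ⁻¹ := by simp [T]
    have hdet : LinearMap.det (T ∘ₗ e.toLinearMap) = 1 := by
      rw [LinearMap.det_comp, hT, ← hδ_def, inv_mul_cancel₀ hδ]
    refine ⟨LinearMap.equivOfDetNeZero (T ∘ₗ e.toLinearMap) (by rw [hdet]; exact one_ne_zero),
      hdet, fun i => ?_⟩
    change T (e (u i)) = v i
    have h1 : u i = bu i.castSucc := by simp [bu]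
    have h2 : v i = bv i.castSucc := by simp [bv]
    have h3 : e (bu i.castSucc) = bv i.castSucc := by simp [e]
    rw [h1, h2, h3]
    simp [T, LinearMap.transvection.apply, Fin.castSucc_ne_last]

lemma linearIndependent_of_wedge_ne_zero {a b : W} (h : wedge (F := F) a b ≠ 0) :
    LinearIndependent F ![a, b] := by
  refine LinearIndependent.pair_iff.2 fun s t hst => ⟨?_, ?_⟩
  · have := congrArg (fun z => wedge (F := F) z b) hst
    simpa [h] using this
  · have := congrArg (wedge (F := F) a) hst
    simpa [h] using this

/-- A nonzero vector of a plane divides the corresponding decomposable bivector. -/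
lemma exists_wedge_eq_wedge {a b : W} {p r : F} (h : p • a + r • b ≠ 0) :
    ∃ c, wedge (F := F) a b = wedge (p • a + r • b) c := by
  by_cases hp : p = 0
  · have hr : r ≠ 0 := by
      rintro rfl
      simp [hp] at h
    refine ⟨-r⁻¹ • a, ?_⟩
    simp [hp, hr, wedge_swap a b, smul_smul]
  · exact ⟨p⁻¹ • b, by simp [hp, smul_smul]⟩

lemma mem_span_of_wedge_eq_zero {a b : W} (ha : a ≠ 0) (h : wedge (F := F) a b = 0) :
    b ∈ Submodule.span F {a} := by
  obtain ⟨f, hf⟩ := Module.Projective.exists_dual_ne_zero F ha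
  have hc : f a • b = f b • a := by
    rw [← sub_eq_zero, ← contract_wedge, h, map_zero]
  refine Submodule.mem_span_singleton.2 ⟨(f a)⁻¹ * f b, ?_⟩
  rw [mul_smul, ← hc, smul_smul, inv_mul_cancel₀ hf, one_smul]

/-- If every transvection `w ↦ w + f w • a` fixing the nonzero bivector `x` also fixes `y`, then `y`
is proportional to `x`. -/
lemma mem_span_of_wedge_contract_eq_zero [Module.Finite F W] {x y : ↥(⋀[F]^2 W)} (hx : x ≠ 0)
    (h : ∀ (f : Module.Dual F W) (a : W), f a = 0 → wedge (F := F) a (contract f x) = 0 →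
      wedge (F := F) a (contract f y) = 0) :
    y ∈ Submodule.span F {x} := by
  refine mem_span_of_contract_mem_span hx fun f => ?_
  by_cases hfx : contract f x = 0
  · obtain ⟨k, hk⟩ : ∃ k, contract k x ≠ 0 := by
      by_contra! h0
      exact hx (eq_zero_of_contract_eq_zero h0)
    obtain ⟨l, hl⟩ := Module.Projective.exists_dual_ne_zero F hk
    have hl' : contract l x ≠ 0 := by
      intro h0
      rw [apply_contract_swap, h0, map_zero, neg_zero] at hl
      exact hl rfl
    have hmem : ∀ m, contract m x ≠ 0 → contract f y ∈ Submodule.span F {contract m x} :=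
      fun m hm => mem_span_of_wedge_eq_zero hm <|
        h f _ (by rw [apply_contract_swap, hfx, map_zero, neg_zero]) (by rw [hfx, map_zero])
    obtain ⟨c, hc⟩ := Submodule.mem_span_singleton.1 (hmem k hk)
    obtain ⟨d, hd⟩ := Submodule.mem_span_singleton.1 (hmem l hl')
    have hc0 : c = 0 := by
      have h0 := congrArg l (hc.trans hd.symm)
      simpa [hl] using h0
    simp [← hc, hc0]
  · exact mem_span_of_wedge_eq_zero hfx (h f _ (by simp) (by simp))

/-- Non-proportional decomposable bivectors `wedge a b`, `wedge c d` such that `a, b, c, d` are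
dependent share a linear factor. -/
lemma exists_common_factor {a b c d : W} (hab : wedge (F := F) a b ≠ 0)
    (hcd : wedge (F := F) c d ≠ 0) (h : ¬ LinearIndependent F ![a, b, c, d])
    (hspan : wedge c d ∉ Submodule.span F {wedge (F := F) a b}) :
    ∃ w x y : W, LinearIndependent F ![y, w, x] ∧ wedge (F := F) a b = wedge w x ∧
      wedge (F := F) c d = wedge w y := by
  obtain ⟨k, hk, hk0⟩ : ∃ k : Fin 4 → F, ∑ i, k i • ![a, b, c, d] i = 0 ∧ ∃ i, k i ≠ 0 :=
    Fintype.not_linearIndependent_iff.1 h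
  have hsum : k 0 • a + k 1 • b = (-k 2) • c + (-k 3) • d := by
    simp only [Fin.sum_univ_four] at hk
    change k 0 • a + k 1 • b + k 2 • c + k 3 • d = 0 at hk
    rw [← sub_eq_zero, ← hk]
    module
  have hw : k 0 • a + k 1 • b ≠ 0 := by
    intro h0
    have h01 := LinearIndependent.pair_iff.1 (linearIndependent_of_wedge_ne_zero hab) _ _ h0
    have h23 := LinearIndependent.pair_iff.1 (linearIndependent_of_wedge_ne_zero hcd) _ _
      (hsum ▸ h0)
    obtain ⟨i, hi⟩ := hk0
    fin_cases i <;> simp_all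
  obtain ⟨x, hx⟩ := exists_wedge_eq_wedge hw
  obtain ⟨y, hy⟩ := exists_wedge_eq_wedge (hsum ▸ hw)
  rw [← hsum] at hy
  set w := k 0 • a + k 1 • b
  refine ⟨w, x, y, ?_, hx, hy⟩
  refine linearIndependent_finCons.2 ⟨linearIndependent_of_wedge_ne_zero (hx ▸ hab), fun hmem => ?_⟩
  obtain ⟨r, s, rfl⟩ : ∃ r s : F, r • w + s • x = y := by
    rw [Matrix.range_cons_cons_empty] at hmem
    exact Submodule.mem_span_pair.1 hmem
  refine hspan (Submodule.mem_span_singleton.2 ⟨s, ?_⟩)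
  simp [hx, hy]

end exteriorPower

namespace PLS

variable {V : Type*}

lemma image_mem_lines_s16 (S : PLS V) {π : Equiv.Perm V} (hπ : π ∈ S.aut) {L : Set V}
    (hL : L ∈ S.lines) : π '' L ∈ S.lines := by
  have h : π • L ∈ π • S.lines := Set.smul_mem_smul_set hL
  rwa [MulAction.mem_stabilizer_iff.1 hπ] at h

lemma collinear_image (S : PLS V) {π : Equiv.Perm V} (hπ : π ∈ S.aut) {x y : V}
    (h : S.Collinear x y) : S.Collinear (π x) (π y) := by
  obtain ⟨hxy, L, hL, hx, hy⟩ := h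
  exact ⟨π.injective.ne hxy, _, S.image_mem_lines_s16 hπ hL, ⟨x, hx, rfl⟩, ⟨y, hy, rfl⟩⟩

variable [AddCommGroup V] {G : Subgroup (Equiv.Perm V)}

lemma collinear_zero_sub (S : PLS V) (hG : ∀ v : V, Equiv.addRight v ∈ G) (hGS : G ≤ S.aut)
    {L : Set V} (hL : L ∈ S.lines) {x y : V} (hx : x ∈ L) (hy : y ∈ L) (hxy : x ≠ y) :
    S.Collinear 0 (y - x) := by
  have := S.collinear_image (hGS (hG (-x))) ⟨hxy, L, hL, hx, hy⟩
  simpa [sub_eq_add_neg] using this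

lemma exists_not_collinear_zero (S : PLS V) (hG : ∀ v : V, Equiv.addRight v ∈ G)
    (hGS : G ≤ S.aut) (hS : ¬ S.IsLinearSpace) : ∃ v ≠ 0, ¬ S.Collinear 0 v := by
  by_contra! h
  refine hS fun x y hxy => ?_
  have := S.collinear_image (hGS (hG x)) (h (y - x) (sub_ne_zero.2 hxy.symm))
  simp only [Equiv.coe_addRight, zero_add, sub_add_cancel] at this
  obtain ⟨-, L, hL, hx, hy⟩ := this
  exact ⟨L, ⟨hL, hx, hy⟩, fun L' h' => S.unique_of_pair L' h'.1 L hL x y hxy h'.2.1 h'.2.2 hx hy⟩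

end PLS

open exteriorPower in
lemma exists_mem_slExteriorSquare {F W : Type*} [Field F] [AddCommGroup W] [Module F W]
    {g : W ≃ₗ[F] W} (hg : LinearMap.det g.toLinearMap = 1) :
    ∃ π ∈ slExteriorSquare F W, ∀ x, π x = exteriorPower.map 2 g.toLinearMap x := by
  refine ⟨⟨map 2 g.toLinearMap, map 2 g.symm.toLinearMap, fun x => ?_, fun x => ?_⟩,
    ⟨g, hg, fun x => ?_⟩, fun x => rfl⟩
  · rw [← LinearMap.comp_apply, ← map_comp]
    simp
  · rw [← LinearMap.comp_apply, ← map_comp]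
    simp
  · change (map 2 g.toLinearMap x : ExteriorAlgebra F W) = _
    induction x using wedge_induction with
    | wedge a b => simp [coe_wedge]
    | zero => simp
    | add x y hx hy => simp [hx, hy]
    | smul c x hx => simp [hx]

open exteriorPower in
/-- **Proposition 7.1 (class (R3)).** Let `V = Λ²(V_5(q))` and let `G` be an affine
permutation group of rank 3 on `V` such that the image of `SL_5(q)` under the
exterior-square representation is a normal subgroup of `G₀`.  Then there is no
`F_q`-independent `G`-affine proper partial linear space: in any `G`-affine proper
partial linear space each line through `0` is contained in the `F_q`-span of any of its
nonzero points. -/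
theorem no_independent_pls_exterior_square
    {p e : ℕ} (hp : p.Prime) (he : 1 ≤ e)
    (F : Type*) [Field F] [Fintype F] (hcardF : Fintype.card F = p ^ e)
    (W : Type*) [AddCommGroup W] [Module F W] [Module.Finite F W]
    (hW : Module.finrank F W = 5)
    [Finite ↥(⋀[F]^2 W)]
    (G : Subgroup (Equiv.Perm ↥(⋀[F]^2 W)))
    (haff : IsAffinePermGroup G)
    (hrank : HasTwoZeroStabOrbits G)
    (hsub : ∀ π ∈ slExteriorSquare F W, π ∈ G)
    (hnorm : ∀ h ∈ G, h 0 = 0 →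
      ∀ π ∈ slExteriorSquare F W, h * π * h⁻¹ ∈ slExteriorSquare F W)
    (S : PLS ↥(⋀[F]^2 W)) (hS : S.IsProper) (hGS : G ≤ S.aut) :
    ∀ L ∈ S.lines, (0 : ↥(⋀[F]^2 W)) ∈ L → ∀ x ∈ L, x ≠ 0 →
      L ⊆ (Submodule.span F ({x} : Set ↥(⋀[F]^2 W)) : Set ↥(⋀[F]^2 W)) := by
  intro L hL h0L x hxL hx0 y hyL
  by_contra hyx
  have hy0 : y ≠ 0 := fun h => hyx (h ▸ Submodule.zero_mem _)
  have hxy : x ≠ y := fun h => hyx (h ▸ Submodule.mem_span_singleton_self x)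
  have coll : ∀ {u v}, u ∈ L → v ∈ L → u ≠ v → S.Collinear 0 (v - u) :=
    fun hu hv huv => S.collinear_zero_sub haff.1 hGS hL hu hv huv
  have orbit : ∀ {g : W ≃ₗ[F] W} {z}, LinearMap.det g.toLinearMap = 1 → S.Collinear 0 z →
      S.Collinear 0 (exteriorPower.map 2 g.toLinearMap z) := by
    intro g z hg hz
    obtain ⟨π, hπ, hπg⟩ := exists_mem_slExteriorSquare hg
    have := S.collinear_image (hGS (hsub π hπ)) hz
    simpa [hπg] using this
  have fix : ∀ {g : W ≃ₗ[F] W} {z}, LinearMap.det g.toLinearMap = 1 →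
      exteriorPower.map 2 g.toLinearMap x = x → z ∈ L →
      exteriorPower.map 2 g.toLinearMap z ∈ L := by
    intro g z hg hgx hz
    obtain ⟨π, hπ, hπg⟩ := exists_mem_slExteriorSquare hg
    rw [← hπg] at hgx ⊢
    have hL' := S.image_mem_lines_s16 (hGS (hsub π hπ)) hL
    rw [S.unique_of_pair L hL _ hL' 0 x hx0.symm h0L hxL ⟨0, h0L, by simp [hπg]⟩ ⟨x, hxL, hgx⟩]
    exact ⟨z, hz, rfl⟩
  obtain ⟨v, hv0, hv⟩ := S.exists_not_collinear_zero haff.1 hGS hS.1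
  rcases eq_wedge_or_eq_wedge_add_wedge hW.le hv0 with ⟨a, b, hab, rfl⟩ | ⟨a, b, c, d, habcd, rfl⟩
  · have ncoll : ∀ c d : W, ¬ S.Collinear 0 (wedge (F := F) c d) := by
      intro c d hcd
      obtain ⟨g, hg, hgu⟩ := exists_det_eq_one_of_linearIndependent (by omega)
        (linearIndependent_of_wedge_ne_zero hcd.1.symm) hab
      have h0 : g c = a := hgu 0
      have h1 : g d = b := hgu 1
      have := orbit hg hcd
      rw [map_wedge] at this
      exact hv (by simpa [h0, h1] using this)
    have transv : ∀ (f : Module.Dual F W) (a : W), f a = 0 →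
        wedge (F := F) a (contract f x) = 0 → wedge (F := F) a (contract f y) = 0 := by
      intro f a hfa hax
      have hg : LinearMap.det (LinearEquiv.transvection hfa).toLinearMap = 1 := by
        rw [LinearEquiv.transvection.coe_toLinearMap, LinearMap.transvection.det, hfa, add_zero]
      have hyL' := fix hg (by
        rw [LinearEquiv.transvection.coe_toLinearMap, map_transvection, hax, add_zero]) hyL
      rw [LinearEquiv.transvection.coe_toLinearMap, map_transvection] at hyL'
      by_contra hne
      have := coll hyL hyL' (by simpa using hne)
      rw [add_sub_cancel_left] at this
      exact ncoll _ _ this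
    exact hyx (mem_span_of_wedge_contract_eq_zero hx0 transv)
  · have ncoll : ∀ a' b' c' d' : W, LinearIndependent F ![a', b', c', d'] →
        ¬ S.Collinear 0 (wedge (F := F) a' b' + wedge (F := F) c' d') := by
      intro a' b' c' d' hli hcd
      obtain ⟨g, hg, hgu⟩ := exists_det_eq_one_of_linearIndependent (by omega) hli habcd
      have h0 : g a' = a := hgu 0
      have h1 : g b' = b := hgu 1
      have h2 : g c' = c := hgu 2
      have h3 : g d' = d := hgu 3
      have := orbit hg hcd
      rw [map_add, map_wedge, map_wedge] at this
      exact hv (by simpa [h0, h1, h2, h3] using this)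
    have decomposable : ∀ z, S.Collinear 0 z → ∃ a b : W, z = wedge (F := F) a b := by
      intro z hz
      rcases eq_wedge_or_eq_wedge_add_wedge hW.le hz.1.symm with
        ⟨a, b, -, rfl⟩ | ⟨a, b, c, d, hli, rfl⟩
      · exact ⟨a, b, rfl⟩
      · exact absurd hz (ncoll a b c d hli)
    obtain ⟨a₁, b₁, rfl⟩ := decomposable x (by simpa using coll h0L hxL hx0.symm)
    obtain ⟨a₂, b₂, rfl⟩ := decomposable y (by simpa using coll h0L hyL hy0.symm)
    have hdep : ¬ LinearIndependent F ![a₁, b₁, a₂, b₂] := by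
      intro hli
      have hli' : LinearIndependent F ![b₁, a₁, a₂, b₂] := by
        convert hli.comp _ (Equiv.swap (0 : Fin 4) 1).injective using 1
        ext i
        fin_cases i <;> rfl
      refine ncoll _ _ _ _ hli' ?_
      have := coll hxL hyL hxy
      rwa [sub_eq_add_neg, ← wedge_swap, add_comm] at this
    obtain ⟨w, s, t, hwst, hx', hy'⟩ := exists_common_factor hx0 hy0 hdep hyx
    obtain ⟨r, hr⟩ := exists_linearIndependent_snoc_of_lt_finrank hwst (by omega)
    have htwsr : LinearIndependent F ![t, w, s, r] := by
      have h : ![t, w, s, r] = Fin.snoc ![t, w, s] r := by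
        ext i
        fin_cases i <;> rfl
      rw [h]
      exact hr
    have hrswt : LinearIndependent F ![r, s, -w, t] := by
      rw [Fintype.linearIndependent_iff] at htwsr ⊢
      intro k hk
      have h0 := htwsr ![k 3, -k 2, k 1, k 0] (by
        rw [← hk]
        simp [Fin.sum_univ_four]
        abel)
      simp only [Fin.forall_fin_succ] at h0 ⊢
      simp_all
    obtain ⟨g, hg, hgu⟩ := exists_det_eq_one_of_linearIndependent (by omega) htwsr hrswt
    have hgt : g t = r := hgu 0
    have hgw : g w = s := hgu 1
    have hgs : g s = -w := hgu 2
    have hgy := fix hg (by simp [hx', hgw, hgs, wedge_swap w s]) hyL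
    rw [hy', map_wedge] at hgy
    simp only [LinearEquiv.coe_coe, hgw, hgt] at hgy
    have hsrtw : LinearIndependent F ![s, r, t, w] := by
      convert htwsr.comp ![2, 3, 0, 1] (by decide) using 1
      ext i
      fin_cases i <;> rfl
    have hne : wedge (F := F) w t ≠ wedge s r := by
      intro heq
      refine hsrtw.ne_zero 0 ((Module.forall_dual_apply_eq_zero_iff F s).1 fun f => ?_)
      have hf := congrArg (contract f) heq
      rw [contract_wedge, contract_wedge] at hf
      refine Fintype.linearIndependent_iff.1 hsrtw ![-f r, f s, -f w, f t] ?_ 1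
      rw [← sub_eq_zero.2 hf.symm]
      simp [Fin.sum_univ_four]
      abel
    have := coll (hy' ▸ hyL) hgy hne
    rw [sub_eq_add_neg, ← wedge_swap] at this
    exact ncoll _ _ _ _ hsrtw this
end
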